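/- Let x_1 ∈ (v_1 + L_1)∖{0} and x′ ∈ F^{r−1}, and let R ⊆ L′ contain exactly one element of each coset of x_1Λ′ in L′; set n := card(L′/x_1Λ′) (a finite number). Then Λ′ω′ and L′ω′ are strongly discrete 𝔽_q-subspaces of K, the element u := e_{Λ′ω′}(ω_1)^{−1} is well defined and nonzero, and e_{L′ω′}(x_1ω_1 + x′ω′) · u^n · ∏_{ℓ′∈R, ℓ′∉x_1Λ′} e_{Λ′ω′}((x_1^{−1}ℓ′)ω′) = x_1 · ∏_{ℓ′∈R} (1 − e_{Λ′ω′}((x_1^{−1}(ℓ′ − x′))ω′)·u); moreover both sides are independent of the choice of R. (Key identity of Proposition 13.8.) -/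

import Mathlib

open scoped BigOperators

/-- The pairing of a row vector `x` with a column vector `ω`: `xω = ∑ i, x i * ω i`. -/
noncomputable def rvPair {K : Type*} [Field K] {r : ℕ} (x ω : Fin r → K) : K :=
  ∑ i, x i * ω i

/-- A subset `M` of a seminormed additive group is strongly discrete if `M ∩ B` is finite
for every bounded subset `B`. -/
def StronglyDiscrete {E : Type*} [SeminormedAddCommGroup E] (M : Set E) : Prop :=
  ∀ B : Set E, Bornology.IsBounded B → (M ∩ B).Finite

/-- The exponential function `e_Λ(z) = z·∏_{λ ∈ Λ, λ ≠ 0} (1 - z/λ)` of a subset `Λ ⊆ K`. -/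
noncomputable def expF {K : Type*} [NormedField K] (Λ : Set K) (z : K) : K :=
  z * ∏' l : {l : K // l ∈ Λ ∧ l ≠ 0}, (1 - z / (l : K))

/-- `L′ = {x′ : (0,x′) ∈ L}`. -/
def LpSet {K : Type*} {m : ℕ} (L : Set (K × (Fin m → K))) [Zero K] : Set (Fin m → K) :=
  {x' | ((0 : K), x') ∈ L}

/-- `L₁ = {x₁ : (x₁,x′) ∈ L for some x′}`. -/
def L1Set {K : Type*} {m : ℕ} (L : Set (K × (Fin m → K))) : Set K :=
  {x1 | ∃ x', (x1, x') ∈ L}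

/-- `Λ′ = {λ′ : x₁λ′ ∈ L′ for all x₁ ∈ v₁ + L₁}`. -/
def LamSet {K : Type*} [Field K] {m : ℕ} (L : Set (K × (Fin m → K))) (v1 : K) :
    Set (Fin m → K) :=
  {l' | ∀ x1 : K, x1 - v1 ∈ L1Set L → x1 • l' ∈ LpSet L}

/-- `R` contains exactly one element of each coset of `x₁Λ′` in `L′`. -/
def IsTransv {K : Type*} [Field K] {m : ℕ} (Lp Λ : Set (Fin m → K)) (x1 : K)
    (R : Finset (Fin m → K)) : Prop :=
  (R : Set (Fin m → K)) ⊆ Lp ∧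
    ∀ y ∈ Lp, ∃! t, t ∈ R ∧ y - t ∈ (fun l => x1 • l) '' Λ

open Classical in
/-- The left hand side of the key identity of Proposition 13.8. -/
noncomputable def lhsIdent {K : Type*} [NormedField K] {m : ℕ}
    (Lp Λ : Set (Fin m → K)) (x1 : K) (x' : Fin m → K) (ω1 : K) (ω' : Fin m → K)
    (R : Finset (Fin m → K)) : K :=
  expF ((fun l => rvPair l ω') '' Lp) (x1 * ω1 + rvPair x' ω') *
    (expF ((fun l => rvPair l ω') '' Λ) ω1)⁻¹ ^ R.card *
    ∏ l ∈ R, (if l ∈ (fun t => x1 • t) '' Λ then 1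
      else expF ((fun l => rvPair l ω') '' Λ) (rvPair (x1⁻¹ • l) ω'))

/-- The right hand side of the key identity of Proposition 13.8. -/
noncomputable def rhsIdent {K : Type*} [NormedField K] {m : ℕ}
    (Λ : Set (Fin m → K)) (x1 : K) (x' : Fin m → K) (ω1 : K) (ω' : Fin m → K)
    (R : Finset (Fin m → K)) : K :=
  x1 * ∏ l ∈ R,
    (1 - expF ((fun t => rvPair t ω') '' Λ) (rvPair (x1⁻¹ • (l - x')) ω') *
      (expF ((fun t => rvPair t ω') '' Λ) ω1)⁻¹)

section ExponentialFunction

open Filter Topology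

lemma norm_prod_one_add_sub_one_le {ι K : Type*} [NormedField K] [IsUltrametricDist K]
    (f : ι → K) (T : Finset ι) {ε : ℝ} (hε : 0 ≤ ε) (hε1 : ε ≤ 1) (hf : ∀ i ∈ T, ‖f i‖ ≤ ε) :
    ‖∏ i ∈ T, (1 + f i) - 1‖ ≤ ε := by
  classical
  induction T using Finset.induction_on with
  | empty => simpa using hε
  | insert a s ha ih =>
    have hs := ih fun i hi => hf i (Finset.mem_insert_of_mem hi)
    have hfa := hf a (Finset.mem_insert_self a s)
    rw [Finset.prod_insert ha]
    have h : (1 + f a) * ∏ i ∈ s, (1 + f i) - 1 =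
        (1 + f a) * (∏ i ∈ s, (1 + f i) - 1) + f a := by ring
    rw [h]
    refine (IsUltrametricDist.norm_add_le_max _ _).trans (max_le ?_ hfa)
    rw [norm_mul]
    have h1 : ‖1 + f a‖ ≤ 1 :=
      (IsUltrametricDist.norm_add_le_max _ _).trans (max_le norm_one.le (hfa.trans hε1))
    calc ‖1 + f a‖ * ‖∏ i ∈ s, (1 + f i) - 1‖ ≤ 1 * ε :=
          mul_le_mul h1 hs (norm_nonneg _) zero_le_one
      _ = ε := one_mul ε

lemma norm_one_add_eq_one {K : Type*} [NormedField K] [IsUltrametricDist K] {x : K}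
    (hx : ‖x‖ < 1) : ‖1 + x‖ = 1 := by
  rw [IsUltrametricDist.norm_add_eq_max_of_norm_ne_norm (by rw [norm_one]; exact hx.ne'),
    norm_one, max_eq_left hx.le]

lemma exists_finset_forall_norm_lt {ι K : Type*} [NormedField K] {f : ι → K}
    (hf : Tendsto f cofinite (𝓝 0)) {ε : ℝ} (hε : 0 < ε) :
    ∃ S : Finset ι, ∀ i ∉ S, ‖f i‖ < ε := by
  have h : ∀ᶠ i in cofinite, ‖f i‖ < ε := by
    have := (tendsto_zero_iff_norm_tendsto_zero.1 hf).eventually (gt_mem_nhds hε)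
    simpa using this
  rw [eventually_cofinite] at h
  exact ⟨h.toFinset, fun i hi => by simpa using hi⟩

lemma norm_prod_one_add_eq_of_subset {ι K : Type*} [NormedField K] [IsUltrametricDist K]
    {f : ι → K} {S T : Finset ι} (hS : ∀ i ∉ S, ‖f i‖ < 1) (hST : S ⊆ T) :
    ‖∏ i ∈ T, (1 + f i)‖ = ‖∏ i ∈ S, (1 + f i)‖ := by
  classical
  rw [← Finset.prod_sdiff hST, norm_mul, norm_prod, Finset.prod_eq_one, one_mul]
  exact fun i hi => norm_one_add_eq_one (hS i (Finset.mem_sdiff.1 hi).2)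

lemma multipliable_one_add_of_tendsto_cofinite {ι K : Type*} [NormedField K]
    [IsUltrametricDist K] [CompleteSpace K] {f : ι → K} (hf : Tendsto f cofinite (𝓝 0)) :
    Multipliable (fun i => 1 + f i) := by
  classical
  obtain ⟨S₀, hS₀⟩ := exists_finset_forall_norm_lt hf one_pos
  set C := ‖∏ i ∈ S₀, (1 + f i)‖ with hC
  have hCauchy : CauchySeq (fun S : Finset ι => ∏ i ∈ S, (1 + f i)) := by
    rw [Metric.cauchySeq_iff']
    intro ε hε
    have hδ : 0 < min 1 (ε / (C + 1)) := lt_min one_pos (by positivity)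
    obtain ⟨S₁, hS₁⟩ := exists_finset_forall_norm_lt hf hδ
    refine ⟨S₀ ∪ S₁, fun T hT => ?_⟩
    have hT' : S₀ ∪ S₁ ⊆ T := hT
    have hle := norm_prod_one_add_sub_one_le f (T \ (S₀ ∪ S₁)) hδ.le (min_le_left _ _)
      fun i hi => (hS₁ i fun h => (Finset.mem_sdiff.1 hi).2 (Finset.mem_union_right _ h)).le
    rw [dist_eq_norm, ← Finset.prod_sdiff hT', ← sub_one_mul, norm_mul,
      norm_prod_one_add_eq_of_subset hS₀ Finset.subset_union_left, ← hC]
    calc _ ≤ ε / (C + 1) * C :=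
          mul_le_mul_of_nonneg_right (hle.trans (min_le_right _ _)) (norm_nonneg _)
      _ < ε := by
          rw [div_mul_eq_mul_div, div_lt_iff₀ (by positivity)]
          nlinarith
  obtain ⟨a, ha⟩ := cauchySeq_tendsto_of_complete hCauchy
  exact ⟨a, by simpa [HasProd] using ha⟩

lemma tprod_one_add_ne_zero {ι K : Type*} [NormedField K]
    [IsUltrametricDist K] [CompleteSpace K] {f : ι → K} (hf : Tendsto f cofinite (𝓝 0))
    (hne : ∀ i, 1 + f i ≠ 0) : ∏' i, (1 + f i) ≠ 0 := by
  obtain ⟨S, hS⟩ := exists_finset_forall_norm_lt hf one_pos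
  have hlim : Tendsto (fun T : Finset ι => ∏ i ∈ T, (1 + f i)) atTop (𝓝 (∏' i, (1 + f i))) := by
    simpa [HasProd] using (multipliable_one_add_of_tendsto_cofinite hf).hasProd
  have heq : ‖∏' i, (1 + f i)‖ = ‖∏ i ∈ S, (1 + f i)‖ :=
    tendsto_nhds_unique hlim.norm <| tendsto_const_nhds.congr' <|
      (eventually_ge_atTop S).mono fun T hT => (norm_prod_one_add_eq_of_subset hS hT).symm
  rw [← norm_ne_zero_iff, heq, norm_ne_zero_iff]
  exact Finset.prod_ne_zero_iff.2 fun i _ => hne i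

lemma StronglyDiscrete.tendsto_div_cofinite {K : Type*} [NormedField K] {Λ : Set K}
    (hΛ : StronglyDiscrete Λ) (z : K) :
    Tendsto (fun l : {l : K // l ∈ Λ ∧ l ≠ 0} => -(z / (l : K))) cofinite (𝓝 0) := by
  rw [tendsto_zero_iff_norm_tendsto_zero, Metric.tendsto_nhds]
  intro ε hε
  rw [eventually_cofinite]
  refine Set.Finite.of_finite_image (f := Subtype.val)
    ((hΛ (Metric.closedBall 0 (‖z‖ / ε)) Metric.isBounded_closedBall).subset ?_)
    Subtype.val_injective.injOn
  rintro _ ⟨⟨l, hl, hl0⟩, h, rfl⟩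
  refine ⟨hl, ?_⟩
  have hlpos : 0 < ‖l‖ := norm_pos_iff.2 hl0
  simp only [norm_neg, norm_div, Real.dist_eq, sub_zero, Set.mem_ofPred_eq, not_lt,
    abs_of_nonneg (div_nonneg (norm_nonneg z) (norm_nonneg l))] at h
  rw [le_div_iff₀ hlpos] at h
  rw [mem_closedBall_zero_iff, le_div_iff₀ hε, mul_comm]
  exact h

lemma StronglyDiscrete.multipliable {K : Type*} [NormedField K] [IsUltrametricDist K]
    [CompleteSpace K] {Λ : Set K} (hΛ : StronglyDiscrete Λ) (z : K) :
    Multipliable (fun l : {l : K // l ∈ Λ ∧ l ≠ 0} => 1 - z / (l : K)) := by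
  simpa only [sub_eq_add_neg] using
    multipliable_one_add_of_tendsto_cofinite (hΛ.tendsto_div_cofinite z)

lemma expF_ne_zero {K : Type*} [NormedField K] [IsUltrametricDist K]
    [CompleteSpace K] {Λ : Set K} (hΛ : StronglyDiscrete Λ) {z : K} (hz : z ≠ 0) (hzΛ : z ∉ Λ) :
    expF Λ z ≠ 0 := by
  refine mul_ne_zero hz ?_
  simp only [sub_eq_add_neg]
  refine tprod_one_add_ne_zero (hΛ.tendsto_div_cofinite z) fun ⟨l, hl, hl0⟩ h => hzΛ ?_
  rw [← sub_eq_add_neg, sub_eq_zero, eq_div_iff hl0, one_mul] at h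
  exact h ▸ hl

lemma expF_eq_zero_of_mem {K : Type*} [NormedField K] {Λ : Set K} {z : K} (hz : z ∈ Λ) :
    expF Λ z = 0 := by
  by_cases h : z = 0
  · simp [expF, h]
  · rw [expF, tprod_of_exists_eq_zero ⟨⟨z, hz, h⟩, by simp [h]⟩, mul_zero]

lemma expF_mul_left {K : Type*} [NormedField K] (Λ : Set K) {c : K} (hc : c ≠ 0) (z : K) :
    expF Λ (c * z) = c * expF {y | c * y ∈ Λ} z := by
  let e : {l : K // l ∈ {y | c * y ∈ Λ} ∧ l ≠ 0} ≃ {l : K // l ∈ Λ ∧ l ≠ 0} :=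
    (Equiv.mulLeft₀ c hc).subtypeEquiv fun l => by simp [hc]
  rw [expF, expF, mul_assoc, ← e.tprod_eq]
  congr 2
  refine tprod_congr fun l => ?_
  change 1 - c * z / (c * (l : K)) = _
  rw [mul_div_mul_left _ _ hc]

/-- The finite product `z * ∏_{w ∈ S, w ≠ 0} (1 - z / w)` for a finite set `S` containing `0`. -/
noncomputable def truncExp {K : Type*} [Field K] (S : Finset K) (z : K) : K :=
  open Classical in ∏ w ∈ S, if w = 0 then z else 1 - z / w

lemma truncExp_eq_zero_of_mem {K : Type*} [Field K] {S : Finset K} {z : K} (hz : z ∈ S) :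
    truncExp S z = 0 :=
  Finset.prod_eq_zero hz (by by_cases h : z = 0 <;> simp [h])

lemma truncExp_eq_mul_prod_sub {K : Type*} [Field K] (S : Finset K) :
    ∃ c : K, ∀ z, truncExp S z = c * ∏ w ∈ S, (z - w) := by
  classical
  refine ⟨∏ w ∈ S, if w = 0 then 1 else -w⁻¹, fun z => ?_⟩
  rw [truncExp, ← Finset.prod_mul_distrib]
  refine Finset.prod_congr rfl fun w _ => ?_
  split_ifs with h
  · simp [h]
  · field_simp
    ring

lemma prod_sub_add_of_addSubgroup {K : Type*} [Field K] {S : Finset K} {W : AddSubgroup K}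
    (hW : (W : Set K) = S) (x y : K) :
    ∏ w ∈ S, (x + y - w) = ∏ w ∈ S, (x - w) + ∏ w ∈ S, (y - w) := by
  classical
  have hmem : ∀ z, z ∈ S ↔ z ∈ W := fun z => by
    rw [← Finset.mem_coe, ← hW, SetLike.mem_coe]
  let P : Polynomial K := ∏ w ∈ S, (Polynomial.X - Polynomial.C w)
  have hPeval : ∀ z, P.eval z = ∏ w ∈ S, (z - w) := fun z => by
    simp [P, Polynomial.eval_prod]
  have hPmonic : P.Monic := Polynomial.monic_prod_of_monic _ _ fun w _ => Polynomial.monic_X_sub_C w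
  have hPdeg : P.natDegree = S.card := by simp [P]
  have hinv : ∀ w ∈ S, P.eval (w + y) = P.eval y := fun w hw => by
    rw [hPeval, hPeval]
    refine Finset.prod_bij' (fun a _ => a - w) (fun a _ => a + w) ?_ ?_ ?_ ?_ ?_
    · exact fun a ha => (hmem _).2 (W.sub_mem ((hmem _).1 ha) ((hmem _).1 hw))
    · exact fun a ha => (hmem _).2 (W.add_mem ((hmem _).1 ha) ((hmem _).1 hw))
    · intros; ring
    · intros; ring
    · intros; ring
  have hroot : ∀ w ∈ S, P.eval w = 0 := fun w hw => by
    rw [hPeval]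
    exact Finset.prod_eq_zero hw (sub_self w)
  have hpos : 0 < S.card := Finset.card_pos.2 ⟨0, (hmem 0).2 W.zero_mem⟩
  let Q : Polynomial K := P.comp (Polynomial.X + Polynomial.C y)
  have hQmonic : Q.Monic := hPmonic.comp_X_add_C y
  have hQdeg : Q.natDegree = S.card := by
    simp [Q, Polynomial.natDegree_comp, hPdeg]
  have hdiff : (Q - P - Polynomial.C (P.eval y)).degree < S.card := by
    have h1 : (Q - P).degree < S.card := by
      have := Polynomial.degree_sub_lt_left (p := Q) (q := P)
        (by rw [Polynomial.degree_eq_natDegree hQmonic.ne_zero,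
          Polynomial.degree_eq_natDegree hPmonic.ne_zero, hQdeg, hPdeg]) hQmonic.ne_zero
        (by rw [hQmonic.leadingCoeff, hPmonic.leadingCoeff])
      rwa [Polynomial.degree_eq_natDegree hQmonic.ne_zero, hQdeg] at this
    refine (Polynomial.degree_sub_le _ _).trans_lt (max_lt h1 ?_)
    exact Polynomial.degree_C_le.trans_lt (by exact_mod_cast hpos)
  have hzero : Q - P - Polynomial.C (P.eval y) = 0 :=
    Polynomial.eq_zero_of_degree_lt_of_eval_finset_eq_zero S hdiff fun w hw => by
      simp [Q, hinv w hw, hroot w hw]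
  have hx := congrArg (Polynomial.eval x) hzero
  simp only [Q, Polynomial.eval_sub, Polynomial.eval_comp, Polynomial.eval_add, Polynomial.eval_X,
    Polynomial.eval_C, Polynomial.eval_zero] at hx
  rw [← hPeval, ← hPeval, ← hPeval]
  linear_combination hx

lemma truncExp_add {K : Type*} [Field K] {S : Finset K} {W : AddSubgroup K}
    (hW : (W : Set K) = S) (x y : K) :
    truncExp S (x + y) = truncExp S x + truncExp S y := by
  obtain ⟨c, hc⟩ := truncExp_eq_mul_prod_sub S
  rw [hc, hc, hc, prod_sub_add_of_addSubgroup hW, mul_add]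

/-- The elements of norm at most `n` of a strongly discrete subset. -/
noncomputable def StronglyDiscrete.ballFinset {K : Type*} [NormedField K] {Λ : Set K}
    (hΛ : StronglyDiscrete Λ) (n : ℕ) : Finset K :=
  (hΛ (Metric.closedBall 0 n) Metric.isBounded_closedBall).toFinset

lemma StronglyDiscrete.mem_ballFinset {K : Type*} [NormedField K] {Λ : Set K}
    (hΛ : StronglyDiscrete Λ) {n : ℕ} {z : K} : z ∈ hΛ.ballFinset n ↔ z ∈ Λ ∧ ‖z‖ ≤ n := by
  simp [StronglyDiscrete.ballFinset]

lemma StronglyDiscrete.exists_addSubgroup_eq_ballFinset {K : Type*} [NormedField K]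
    [IsUltrametricDist K] {M : AddSubgroup K} (hM : StronglyDiscrete (M : Set K)) (n : ℕ) :
    ∃ W : AddSubgroup K, (W : Set K) = hM.ballFinset n := by
  refine ⟨{ carrier := hM.ballFinset n, add_mem' := ?_, zero_mem' := ?_, neg_mem' := ?_ }, rfl⟩
  · intro a b ha hb
    simp only [Finset.mem_coe, hM.mem_ballFinset] at *
    exact ⟨M.add_mem ha.1 hb.1,
      (IsUltrametricDist.norm_add_le_max _ _).trans (max_le ha.2 hb.2)⟩
  · simp only [Finset.mem_coe, hM.mem_ballFinset]
    exact ⟨M.zero_mem, by simp⟩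
  · intro a ha
    simp only [Finset.mem_coe, hM.mem_ballFinset] at *
    exact ⟨M.neg_mem ha.1, by simpa using ha.2⟩

lemma StronglyDiscrete.tendsto_truncExp {K : Type*} [NormedField K] [IsUltrametricDist K]
    [CompleteSpace K] {Λ : Set K} (hΛ : StronglyDiscrete Λ) (h0 : (0 : K) ∈ Λ) (z : K) :
    Tendsto (fun n => truncExp (hΛ.ballFinset n) z) atTop (𝓝 (expF Λ z)) := by
  classical
  let T : ℕ → Finset {l : K // l ∈ Λ ∧ l ≠ 0} := fun n => (hΛ.ballFinset n).subtype _
  have hT : Tendsto T atTop atTop := by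
    refine tendsto_atTop_finset_of_monotone (fun a b hab l hl => ?_) fun l => ?_
    · simp only [T, Finset.mem_subtype, hΛ.mem_ballFinset] at *
      exact ⟨hl.1, hl.2.trans (by exact_mod_cast hab)⟩
    · obtain ⟨n, hn⟩ := exists_nat_ge ‖(l : K)‖
      exact ⟨n, by simpa [T, hΛ.mem_ballFinset] using ⟨l.2.1, hn⟩⟩
  have hprod : Tendsto (fun S : Finset {l : K // l ∈ Λ ∧ l ≠ 0} => ∏ l ∈ S, (1 - z / (l : K)))
      atTop (𝓝 (∏' l : {l : K // l ∈ Λ ∧ l ≠ 0}, (1 - z / (l : K)))) := by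
    simpa [HasProd] using (hΛ.multipliable z).hasProd
  refine ((hprod.comp hT).const_mul z).congr fun n => ?_
  have hmem : (0 : K) ∈ hΛ.ballFinset n := hΛ.mem_ballFinset.2 ⟨h0, by simp⟩
  rw [truncExp, ← Finset.mul_prod_erase _ _ hmem, if_pos rfl]
  congr 1
  refine Finset.prod_bij (fun l _ => (l : K)) ?_ ?_ ?_ ?_
  · intro l hl
    exact Finset.mem_erase.2 ⟨l.2.2, by simpa [T] using hl⟩
  · exact fun a _ b _ h => Subtype.ext h
  · intro b hb
    rw [Finset.mem_erase] at hb
    exact ⟨⟨b, (hΛ.mem_ballFinset.1 hb.2).1, hb.1⟩, by simpa [T] using hb.2, rfl⟩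
  · intro l _
    rw [if_neg l.2.2]

lemma expF_add {K : Type*} [NormedField K] [IsUltrametricDist K] [CompleteSpace K]
    {M : AddSubgroup K} (hM : StronglyDiscrete (M : Set K)) (x y : K) :
    expF (M : Set K) (x + y) = expF M x + expF M y := by
  refine tendsto_nhds_unique (hM.tendsto_truncExp M.zero_mem (x + y)) ?_
  refine ((hM.tendsto_truncExp M.zero_mem x).add (hM.tendsto_truncExp M.zero_mem y)).congr
    fun n => ?_
  obtain ⟨W, hW⟩ := hM.exists_addSubgroup_eq_ballFinset n
  exact (truncExp_add hW x y).symm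

lemma expF_sub {K : Type*} [NormedField K] [IsUltrametricDist K] [CompleteSpace K]
    {M : AddSubgroup K} (hM : StronglyDiscrete (M : Set K)) (x y : K) :
    expF (M : Set K) (x - y) = expF M x - expF M y := by
  rw [eq_sub_iff_add_eq, ← expF_add hM, sub_add_cancel]

end ExponentialFunction

section CosetRepresentatives

open Filter Topology

/-- The family `ρ` restricted to `R` contains exactly one element of each coset of `N` in `M`. -/
def IsCosetReps {ι V : Type*} [AddCommGroup V] (M N : AddSubgroup V) (R : Finset ι)
    (ρ : ι → V) : Prop :=
  (∀ t ∈ R, ρ t ∈ M) ∧ ∀ y ∈ M, ∃! t, t ∈ R ∧ y - ρ t ∈ N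

lemma IsCosetReps.neg {ι V : Type*} [AddCommGroup V] {M N : AddSubgroup V} {R : Finset ι}
    {ρ : ι → V} (h : IsCosetReps M N R ρ) : IsCosetReps M N R (fun t => -ρ t) := by
  refine ⟨fun t ht => M.neg_mem (h.1 t ht), fun y hy => ?_⟩
  have h2 := h.2 (-y) (M.neg_mem hy)
  have key : ∀ t, y - -ρ t ∈ N ↔ -y - ρ t ∈ N := fun t => by
    rw [← N.neg_mem_iff, neg_sub, sub_eq_add_neg, add_comm, ← sub_eq_add_neg]
  simpa only [key] using h2

lemma IsCosetReps.prod_eq {ι κ V α : Type*} [AddCommGroup V] [CommMonoid α]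
    {M N : AddSubgroup V} {R : Finset ι} {ρ : ι → V} {S : Finset κ} {σ : κ → V}
    (hR : IsCosetReps M N R ρ) (hS : IsCosetReps M N S σ) {f : V → α}
    (hf : ∀ a b, a - b ∈ N → f a = f b) :
    ∏ t ∈ R, f (ρ t) = ∏ s ∈ S, f (σ s) := by
  choose i hi _ using fun t (ht : t ∈ R) => hS.2 (ρ t) (hR.1 t ht)
  choose j hj _ using fun s (hs : s ∈ S) => hR.2 (σ s) (hS.1 s hs)
  refine Finset.prod_bij i (fun t ht => (hi t ht).1) ?_ ?_
    fun t ht => hf _ _ (hi t ht).2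
  · intro a ha b hb hab
    have hb' := (hi b hb).2
    rw [← hab] at hb'
    refine (hR.2 (ρ a) (hR.1 a ha)).unique ⟨ha, by simp⟩ ⟨hb, ?_⟩
    simpa using N.sub_mem (hi a ha).2 hb'
  · intro s hs
    refine ⟨j s hs, (hj s hs).1, ?_⟩
    have hjs := hj s hs
    refine (hS.2 (ρ (j s hs)) (hR.1 _ hjs.1)).unique (hi _ hjs.1) ⟨hs, ?_⟩
    rw [← neg_sub]
    exact N.neg_mem hjs.2

lemma IsCosetReps.prod_prod_add_eq {ι V α : Type*} [AddCommGroup V] [CommMonoid α]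
    {M N : AddSubgroup V} {R : Finset ι} {ρ : ι → V} (hR : IsCosetReps M N R ρ) (hNM : N ≤ M)
    {S T : Finset V} (hS : (M : Set V) = S) (hT : (N : Set V) = T) (f : V → α) :
    ∏ w ∈ S, f w = ∏ t ∈ R, ∏ ν ∈ T, f (ρ t + ν) := by
  have hmS : ∀ z, z ∈ S ↔ z ∈ M := fun z => by rw [← Finset.mem_coe, ← hS, SetLike.mem_coe]
  have hmT : ∀ z, z ∈ T ↔ z ∈ N := fun z => by rw [← Finset.mem_coe, ← hT, SetLike.mem_coe]
  rw [← Finset.prod_product' (f := fun t ν => f (ρ t + ν))]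
  symm
  refine Finset.prod_bij (fun p _ => ρ p.1 + p.2) ?_ ?_ ?_ fun _ _ => rfl
  · intro p hp
    rw [Finset.mem_product] at hp
    exact (hmS _).2 (M.add_mem (hR.1 _ hp.1) (hNM ((hmT _).1 hp.2)))
  · rintro ⟨a, ν⟩ hp ⟨b, μ⟩ hq h
    simp only [Finset.mem_product, hmT] at hp hq h
    have hab : a = b := by
      refine (hR.2 (ρ a + ν) (M.add_mem (hR.1 _ hp.1) (hNM hp.2))).unique ⟨hp.1, ?_⟩ ⟨hq.1, ?_⟩
      · simpa using hp.2
      · rw [h]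
        simpa using hq.2
    subst hab
    rw [add_left_cancel h]
  · intro w hw
    obtain ⟨t, ht, -⟩ := hR.2 w ((hmS _).1 hw)
    exact ⟨(t, w - ρ t), Finset.mem_product.2 ⟨ht.1, (hmT _).2 ht.2⟩, by simp⟩

open Classical in
lemma prod_coset_mul_eq_truncExp {K : Type*} [Field K] {N : AddSubgroup K} {T : Finset K}
    (hT : (N : Set K) = T) (z l : K) :
    (∏ ν ∈ T, if l + ν = 0 then z else 1 - z / (l + ν)) *
      (if l ∈ N then 1 else truncExp T (-l)) = truncExp T (z - l) := by
  have hmT : ∀ z, z ∈ T ↔ z ∈ N := fun z => by rw [← Finset.mem_coe, ← hT, SetLike.mem_coe]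
  split_ifs with hl
  · have hz : truncExp T (z - l) = truncExp T z := by
      have := truncExp_add hT (z - l) l
      rw [sub_add_cancel, truncExp_eq_zero_of_mem ((hmT l).2 hl), add_zero] at this
      exact this.symm
    rw [hz, mul_one, truncExp]
    refine Finset.prod_bij' (fun a _ => l + a) (fun a _ => a - l) ?_ ?_ ?_ ?_ ?_
    · exact fun a ha => (hmT _).2 (N.add_mem hl ((hmT _).1 ha))
    · exact fun a ha => (hmT _).2 (N.sub_mem ((hmT _).1 ha) hl)
    · intros; ring
    · intros; ring
    · intros; rfl
  · rw [truncExp, truncExp, ← Finset.prod_mul_distrib]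
    refine Finset.prod_congr rfl fun ν hν => ?_
    have hne : l + ν ≠ 0 := fun h => hl <| by
      rw [eq_neg_of_add_eq_zero_left h]
      exact N.neg_mem ((hmT _).1 hν)
    rw [if_neg hne]
    split_ifs with h0
    · subst h0
      rw [add_zero] at *
      field_simp
      ring
    · field_simp
      ring

open Classical in
lemma truncExp_mul_prod_reps {ι K : Type*} [Field K] {M N : AddSubgroup K} {R : Finset ι}
    {ρ : ι → K} (hR : IsCosetReps M N R ρ) (hNM : N ≤ M)
    {S T : Finset K} (hS : (M : Set K) = S) (hT : (N : Set K) = T) (z : K) :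
    truncExp S z * ∏ t ∈ R, (if ρ t ∈ N then 1 else truncExp T (-ρ t)) =
      ∏ t ∈ R, truncExp T (z - ρ t) := by
  rw [truncExp, hR.prod_prod_add_eq hNM hS hT, ← Finset.prod_mul_distrib]
  exact Finset.prod_congr rfl fun t _ => prod_coset_mul_eq_truncExp hT z (ρ t)

open Classical in
lemma expF_mul_prod_reps {ι K : Type*} [NormedField K] [IsUltrametricDist K] [CompleteSpace K]
    {M N : AddSubgroup K} (hM : StronglyDiscrete (M : Set K)) (hN : StronglyDiscrete (N : Set K))
    (hNM : N ≤ M) {R : Finset ι} {ρ : ι → K} (hR : IsCosetReps M N R ρ) (z : K) :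
    expF M z * ∏ t ∈ R, (if ρ t ∈ N then 1 else expF N (-ρ t)) =
      ∏ t ∈ R, expF N (z - ρ t) := by
  have hlhs : Tendsto (fun n => truncExp (hM.ballFinset n) z *
      ∏ t ∈ R, (if ρ t ∈ N then 1 else truncExp (hN.ballFinset n) (-ρ t))) atTop
      (𝓝 (expF M z * ∏ t ∈ R, (if ρ t ∈ N then 1 else expF N (-ρ t)))) := by
    refine (hM.tendsto_truncExp M.zero_mem z).mul (tendsto_finsetProd R fun t _ => ?_)
    split_ifs
    · exact tendsto_const_nhds
    · exact hN.tendsto_truncExp N.zero_mem _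
  have hrhs : Tendsto (fun n => ∏ t ∈ R, truncExp (hN.ballFinset n) (z - ρ t)) atTop
      (𝓝 (∏ t ∈ R, expF N (z - ρ t))) :=
    tendsto_finsetProd R fun t _ => hN.tendsto_truncExp N.zero_mem _
  refine tendsto_nhds_unique (hlhs.congr' ?_) hrhs
  obtain ⟨n₀, hn₀⟩ := exists_nat_ge (∑ t ∈ R, ‖ρ t‖)
  filter_upwards [eventually_ge_atTop n₀] with n hn
  have hρ : ∀ t ∈ R, ‖ρ t‖ ≤ n := fun t ht =>
    (Finset.single_le_sum (f := fun t => ‖ρ t‖) (fun _ _ => norm_nonneg _) ht).trans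
      (hn₀.trans (by exact_mod_cast hn))
  obtain ⟨W, hW⟩ := hM.exists_addSubgroup_eq_ballFinset n
  obtain ⟨V, hV⟩ := hN.exists_addSubgroup_eq_ballFinset n
  have hmW : ∀ y, y ∈ W ↔ y ∈ M ∧ ‖y‖ ≤ n := fun y => by
    rw [← SetLike.mem_coe, hW, Finset.mem_coe, hM.mem_ballFinset, SetLike.mem_coe]
  have hmV : ∀ y, y ∈ V ↔ y ∈ N ∧ ‖y‖ ≤ n := fun y => by
    rw [← SetLike.mem_coe, hV, Finset.mem_coe, hN.mem_ballFinset, SetLike.mem_coe]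
  have hsub : ∀ y ∈ W, ∀ t ∈ R, (y - ρ t ∈ V ↔ y - ρ t ∈ N) := fun y hy t ht => by
    rw [hmV, and_iff_left]
    rw [sub_eq_add_neg]
    exact (IsUltrametricDist.norm_add_le_max _ _).trans
      (max_le ((hmW y).1 hy).2 (by simpa using hρ t ht))
  have hreps : IsCosetReps W V R ρ := by
    refine ⟨fun t ht => (hmW _).2 ⟨hR.1 t ht, hρ t ht⟩, fun y hy => ?_⟩
    obtain ⟨t, ht, huniq⟩ := hR.2 y ((hmW y).1 hy).1
    exact ⟨t, ⟨ht.1, (hsub y hy t ht.1).2 ht.2⟩,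
      fun s hs => huniq s ⟨hs.1, (hsub y hy s hs.1).1 hs.2⟩⟩
  have hle : V ≤ W := fun y hy => (hmW y).2 ⟨hNM ((hmV y).1 hy).1, ((hmV y).1 hy).2⟩
  rw [← truncExp_mul_prod_reps hreps hle hW hV z]
  congr 1
  refine Finset.prod_congr rfl fun t ht => ?_
  have : ρ t ∈ V ↔ ρ t ∈ N := by rw [hmV, and_iff_left (hρ t ht)]
  simp only [this]

lemma expF_eq_of_sub_mem {K : Type*} [NormedField K] [IsUltrametricDist K] [CompleteSpace K]
    {N : AddSubgroup K} (hN : StronglyDiscrete (N : Set K)) {a b : K} (h : a - b ∈ N) :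
    expF (N : Set K) a = expF N b := by
  rw [← sub_eq_zero, ← expF_sub hN]
  exact expF_eq_zero_of_mem h

open Classical in
/-- The key identity for two strongly discrete subgroups of `K`. -/
lemma expF_mul_inv_pow_mul_prod_reps {ι K : Type*} [NormedField K] [IsUltrametricDist K]
    [CompleteSpace K] {M N : AddSubgroup K} (hM : StronglyDiscrete (M : Set K))
    (hN : StronglyDiscrete (N : Set K)) (hNM : N ≤ M) {R : Finset ι} {ρ : ι → K}
    (hR : IsCosetReps M N R ρ) {w : K} (hw : expF (N : Set K) w ≠ 0) (y : K) :
    expF M (w + y) * (expF N w)⁻¹ ^ R.card *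
        ∏ t ∈ R, (if ρ t ∈ N then 1 else expF N (ρ t)) =
      ∏ t ∈ R, (1 - expF N (ρ t - y) * (expF N w)⁻¹) := by
  have hneg : ∏ t ∈ R, (if ρ t ∈ N then 1 else expF N (-ρ t)) =
      ∏ t ∈ R, (if ρ t ∈ N then 1 else expF N (ρ t)) := by
    have h := hR.neg.prod_eq hR (f := fun z => if z ∈ N then 1 else expF (N : Set K) z)
      fun a b hab => by
        have : a ∈ N ↔ b ∈ N := by
          rw [← sub_add_cancel a b]
          exact N.add_mem_cancel_left hab
        simp only [this, expF_eq_of_sub_mem hN hab]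
    simpa only [N.neg_mem_iff] using h
  have hprod := expF_mul_prod_reps hM hN hNM hR (w + y)
  rw [hneg] at hprod
  rw [mul_right_comm, hprod, ← Finset.prod_const, ← Finset.prod_mul_distrib]
  refine Finset.prod_congr rfl fun t _ => ?_
  rw [show w + y - ρ t = w - (ρ t - y) by ring, expF_sub hN, sub_mul, mul_inv_cancel₀ hw]

end CosetRepresentatives

section Discreteness

lemma StronglyDiscrete.mono {E : Type*} [SeminormedAddCommGroup E] {S T : Set E}
    (hT : StronglyDiscrete T) (h : S ⊆ T) : StronglyDiscrete S :=
  fun B hB => (hT B hB).subset (Set.inter_subset_inter_left B h)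

lemma StronglyDiscrete.preimage_mul_left {K : Type*} [NormedField K] {Λ : Set K}
    (hΛ : StronglyDiscrete Λ) {c : K} (hc : c ≠ 0) : StronglyDiscrete {y | c * y ∈ Λ} := by
  intro B hB
  obtain ⟨C, hC⟩ := hB.exists_norm_le
  refine Set.Finite.of_finite_image
    ((hΛ (Metric.closedBall 0 (‖c‖ * C)) Metric.isBounded_closedBall).subset ?_)
    (mul_right_injective₀ hc).injOn
  rintro _ ⟨y, ⟨hy, hyB⟩, rfl⟩
  refine ⟨hy, ?_⟩
  rw [mem_closedBall_zero_iff, norm_mul]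
  exact mul_le_mul_of_nonneg_left (hC y hyB) (norm_nonneg c)

lemma rvPair_add {K : Type*} [Field K] {r : ℕ} (x y ω : Fin r → K) :
    rvPair (x + y) ω = rvPair x ω + rvPair y ω := by
  simp [rvPair, add_mul, Finset.sum_add_distrib]

lemma rvPair_smul {K : Type*} [Field K] {r : ℕ} (c : K) (x ω : Fin r → K) :
    rvPair (c • x) ω = c * rvPair x ω := by
  simp [rvPair, Finset.mul_sum, mul_assoc]

lemma rvPair_neg {K : Type*} [Field K] {r : ℕ} (x ω : Fin r → K) :
    rvPair (-x) ω = -rvPair x ω := by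
  simp [rvPair]

lemma rvPair_sub {K : Type*} [Field K] {r : ℕ} (x y ω : Fin r → K) :
    rvPair (x - y) ω = rvPair x ω - rvPair y ω := by
  rw [sub_eq_add_neg, rvPair_add, rvPair_neg, sub_eq_add_neg]

/-- Pairing with `ω`, as an additive map. -/
noncomputable def rvPairHom {K : Type*} [Field K] {r : ℕ} (ω : Fin r → K) : (Fin r → K) →+ K where
  toFun x := rvPair x ω
  map_zero' := by simp [rvPair]
  map_add' x y := rvPair_add x y ω

lemma exists_norm_le_mul_norm_rvPair {K : Type*} [NormedField K] [CompleteSpace K]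
    {Finf : Subfield K} (hclosed : IsClosed (Finf : Set K)) (hnt : ∃ x ∈ Finf, 1 < ‖x‖)
    {m : ℕ} {ω : Fin m → K}
    (hω : ∀ c : Fin m → K, (∀ i, c i ∈ Finf) → rvPair c ω = 0 → c = 0) :
    ∃ D : ℝ, 0 < D ∧ ∀ c : Fin m → K, (∀ i, c i ∈ Finf) → ‖c‖ ≤ D * ‖rvPair c ω‖ := by
  let : NontriviallyNormedField Finf :=
    { SubfieldClass.toNormedField Finf with
      non_trivial := let ⟨x, hx, h⟩ := hnt; ⟨⟨x, hx⟩, h⟩ }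
  have : CompleteSpace Finf := hclosed.completeSpace_coe
  let : NormedSpace Finf K :=
    { (inferInstance : Module Finf K) with
      norm_smul_le := fun a b => (norm_mul (a : K) b).le }
  let f : (Fin m → Finf) →ₗ[Finf] K :=
    { toFun := fun c => rvPair (fun i => (c i : K)) ω
      map_add' := fun x y => rvPair_add _ _ ω
      map_smul' := fun a x => rvPair_smul (a : K) _ ω }
  have hker : LinearMap.ker f = ⊥ := by
    rw [LinearMap.ker_eq_bot']
    intro c hc
    have := hω (fun i => (c i : K)) (fun i => (c i).2) hc
    ext i
    exact congrFun this i
  obtain ⟨D, hD, hanti⟩ := f.exists_antilipschitzWith hker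
  refine ⟨D, hD, fun c hc => ?_⟩
  have h := hanti.le_mul_dist (fun i => ⟨c i, hc i⟩) 0
  rw [map_zero, dist_zero_right, dist_zero_right] at h
  exact h

lemma StronglyDiscrete.image_rvPair {K : Type*} [NormedField K] [CompleteSpace K]
    {Finf : Subfield K} (hclosed : IsClosed (Finf : Set K)) {m : ℕ} {ω : Fin m → K}
    (hω : ∀ c : Fin m → K, (∀ i, c i ∈ Finf) → rvPair c ω = 0 → c = 0)
    {S : Set (Fin m → K)} (hS : StronglyDiscrete S) (hSF : ∀ x ∈ S, ∀ i, x i ∈ Finf) :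
    StronglyDiscrete ((fun l => rvPair l ω) '' S) := by
  by_cases hnt : ∃ x ∈ Finf, 1 < ‖x‖
  · obtain ⟨D, hD, hbound⟩ := exists_norm_le_mul_norm_rvPair hclosed hnt hω
    intro B hB
    obtain ⟨C, hC⟩ := hB.exists_norm_le
    refine ((hS (Metric.closedBall 0 (D * C)) Metric.isBounded_closedBall).image
      (fun l => rvPair l ω)).subset ?_
    rintro _ ⟨⟨x, hx, rfl⟩, hxB⟩
    refine ⟨x, ⟨hx, ?_⟩, rfl⟩
    rw [mem_closedBall_zero_iff]
    exact (hbound x (hSF x hx)).trans (mul_le_mul_of_nonneg_left (hC _ hxB) hD.le)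
  · push Not at hnt
    have hfin : S.Finite := by
      refine (hS (Metric.closedBall 0 1) Metric.isBounded_closedBall).subset fun x hx => ⟨hx, ?_⟩
      rw [mem_closedBall_zero_iff]
      exact (pi_norm_le_iff_of_nonneg zero_le_one).2 fun i => hnt _ (hSF x hx i)
    exact fun B _ => (hfin.image _).subset Set.inter_subset_left

lemma StronglyDiscrete.lpSet {K : Type*} [NormedField K] {m : ℕ} {L : Set (K × (Fin m → K))}
    (hL : StronglyDiscrete L) : StronglyDiscrete (LpSet L) := by
  intro B hB
  obtain ⟨C, hC⟩ := hB.exists_norm_le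
  refine Set.Finite.of_finite_image (f := fun x => ((0 : K), x))
    ((hL (Metric.closedBall 0 C) Metric.isBounded_closedBall).subset ?_)
    (Prod.mk_right_injective 0).injOn
  rintro _ ⟨x, ⟨hx, hxB⟩, rfl⟩
  refine ⟨hx, ?_⟩
  rw [mem_closedBall_zero_iff]
  exact norm_prod_le_iff.2 ⟨by simpa using (norm_nonneg x).trans (hC x hxB), hC x hxB⟩

end Discreteness

/-- key identity of Proposition 13.8. -/
theorem key_identity
    (K : Type*) [NontriviallyNormedField K] [IsUltrametricDist K] [CompleteSpace K]
    [IsAlgClosed K]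
    (Finf : Subfield K) (hFinfclosed : IsClosed (Finf : Set K))
    (hFinfloc : LocallyCompactSpace Finf)
    (Fq : Subfield K) (hFqfin : Finite Fq)
    (A : Subring K) (hFqA : (Fq : Set K) ⊆ A)
    (F : Subfield K) (hAF : (A : Set K) ⊆ F) (hFFinf : F ≤ Finf)
    (hDed : IsDedekindDomain A)
    (hFrac : ∀ z ∈ F, ∃ a ∈ A, ∃ b ∈ A, b ≠ 0 ∧ z * b = a)
    (hquot : ∀ I : Ideal A, I ≠ ⊥ → Finite (A ⧸ I))
    (m : ℕ) (hm : 1 ≤ m)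
    (L : Set (K × (Fin m → K)))
    (hLsub : ∃ G : AddSubgroup (K × (Fin m → K)), (G : Set (K × (Fin m → K))) = L)
    (hLF : ∀ x ∈ L, x.1 ∈ F ∧ ∀ i, x.2 i ∈ F)
    (hLA : ∀ a ∈ (A : Set K), ∀ x ∈ L, a • x ∈ L)
    (hLfg : ∃ T : Finset (K × (Fin m → K)), (T : Set (K × (Fin m → K))) ⊆ L ∧
      ∀ x ∈ L, x ∈ AddSubgroup.closure
        {y | ∃ a ∈ (A : Set K), ∃ t ∈ (T : Set (K × (Fin m → K))), y = a • t})
    (hLspan : ∀ y : K × (Fin m → K), (y.1 ∈ F ∧ ∀ i, y.2 i ∈ F) →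
      y ∈ AddSubgroup.closure {z | ∃ c ∈ (F : Set K), ∃ x ∈ L, z = c • x})
    (hLdisc : StronglyDiscrete L)
    (v : K × (Fin m → K)) (hvF : v.1 ∈ F ∧ ∀ i, v.2 i ∈ F)
    (x1 : K) (hx1 : x1 - v.1 ∈ L1Set L) (hx1ne : x1 ≠ 0)
    (x' : Fin m → K) (hx'F : ∀ i, x' i ∈ F)
    (R : Finset (Fin m → K)) (hR : IsTransv (LpSet L) (LamSet L v.1) x1 R)
    (ω1 : K) (ω' : Fin m → K)
    (hω : ∀ (c : K) (c' : Fin m → K), c ∈ Finf → (∀ i, c' i ∈ Finf) →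
      c * ω1 + rvPair c' ω' = 0 → c = 0 ∧ c' = 0) :
    (∃ M : AddSubgroup K,
        (M : Set K) = (fun l => rvPair l ω') '' LamSet L v.1) ∧
    (∀ c ∈ Fq, ∀ z ∈ (fun l => rvPair l ω') '' LamSet L v.1,
        c * z ∈ (fun l => rvPair l ω') '' LamSet L v.1) ∧
    StronglyDiscrete ((fun l => rvPair l ω') '' LamSet L v.1) ∧
    (∃ M : AddSubgroup K,
        (M : Set K) = (fun l => rvPair l ω') '' LpSet L) ∧
    (∀ c ∈ Fq, ∀ z ∈ (fun l => rvPair l ω') '' LpSet L,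
        c * z ∈ (fun l => rvPair l ω') '' LpSet L) ∧
    StronglyDiscrete ((fun l => rvPair l ω') '' LpSet L) ∧
    Multipliable (fun l : {l : K //
        l ∈ (fun t => rvPair t ω') '' LamSet L v.1 ∧ l ≠ 0} => 1 - ω1 / (l : K)) ∧
    expF ((fun l => rvPair l ω') '' LamSet L v.1) ω1 ≠ 0 ∧
    lhsIdent (LpSet L) (LamSet L v.1) x1 x' ω1 ω' R =
      rhsIdent (LamSet L v.1) x1 x' ω1 ω' R ∧
    (∀ R2 : Finset (Fin m → K), IsTransv (LpSet L) (LamSet L v.1) x1 R2 →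
      lhsIdent (LpSet L) (LamSet L v.1) x1 x' ω1 ω' R =
        lhsIdent (LpSet L) (LamSet L v.1) x1 x' ω1 ω' R2 ∧
      rhsIdent (LamSet L v.1) x1 x' ω1 ω' R =
        rhsIdent (LamSet L v.1) x1 x' ω1 ω' R2) := by
  classical
  obtain ⟨G, rfl⟩ := hLsub
  have hωinj : ∀ c : Fin m → K, (∀ i, c i ∈ Finf) → rvPair c ω' = 0 → c = 0 := fun c hc h =>
    (hω 0 c Finf.zero_mem hc (by rw [zero_mul, zero_add, h])).2
  have hLpF : ∀ x ∈ LpSet (G : Set (K × (Fin m → K))), ∀ i, x i ∈ F := fun x hx => (hLF _ hx).2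
  have hL1F : ∀ x ∈ L1Set (G : Set (K × (Fin m → K))), x ∈ F := fun x ⟨y, hy⟩ => (hLF _ hy).1
  have hx1F : x1 ∈ F := by
    simpa using F.add_mem (hL1F _ hx1) hvF.1
  let Lp : AddSubgroup (Fin m → K) := G.comap (AddMonoidHom.inr K (Fin m → K))
  let Lam : AddSubgroup (Fin m → K) :=
    { carrier := LamSet (G : Set (K × (Fin m → K))) v.1
      add_mem' := fun {a b} ha hb x hx => by
        rw [smul_add]
        exact Lp.add_mem (ha x hx) (hb x hx)
      zero_mem' := fun x _ => by
        rw [smul_zero]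
        exact Lp.zero_mem
      neg_mem' := fun {a} ha x hx => by
        rw [smul_neg]
        exact Lp.neg_mem (ha x hx) }
  have hLamLp : ∀ l ∈ Lam, x1 • l ∈ Lp := fun l hl => hl x1 hx1
  have hLamF : ∀ l ∈ Lam, ∀ i, l i ∈ F := fun l hl i => by
    have h := F.mul_mem (F.inv_mem hx1F) (hLpF _ (hLamLp l hl) i)
    rwa [Pi.smul_apply, smul_eq_mul, inv_mul_cancel_left₀ hx1ne] at h
  let M : AddSubgroup K := Lp.map (rvPairHom ω')
  have hM : (M : Set K) = (fun l => rvPair l ω') '' LpSet (G : Set (K × (Fin m → K))) := rfl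
  let N : AddSubgroup K := Lam.map (rvPairHom ω')
  have hN : (N : Set K) = (fun l => rvPair l ω') '' LamSet (G : Set (K × (Fin m → K))) v.1 := rfl
  let M' : AddSubgroup K := M.comap (AddMonoidHom.mulLeft x1)
  have hMdisc : StronglyDiscrete (M : Set K) :=
    hLdisc.lpSet.image_rvPair hFinfclosed hωinj fun x hx i => hFFinf (hLpF x hx i)
  have hM'disc : StronglyDiscrete (M' : Set K) := hMdisc.preimage_mul_left hx1ne
  have hNM' : N ≤ M' := by
    rintro _ ⟨l, hl, rfl⟩
    exact ⟨x1 • l, hLamLp l hl, rvPair_smul x1 l ω'⟩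
  have hNdisc : StronglyDiscrete (N : Set K) := hM'disc.mono hNM'
  have hω1 : ω1 ∉ N := by
    rintro ⟨l, hl, h⟩
    have h1 := hω 1 (-l) Finf.one_mem (fun i => Finf.neg_mem (hFFinf (hLamF l hl i)))
      (by rw [rvPair_neg, one_mul, ← h]; exact add_neg_cancel _)
    exact one_ne_zero h1.1
  have hexp : expF (N : Set K) ω1 ≠ 0 :=
    expF_ne_zero hNdisc (fun h => hω1 (h ▸ N.zero_mem)) hω1
  have hmemN : ∀ l : Fin m → K, (∀ i, l i ∈ F) →
      (x1⁻¹ * rvPair l ω' ∈ N ↔ l ∈ (fun t => x1 • t) '' LamSet (G : Set (K × (Fin m → K))) v.1) := by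
    intro l hl
    constructor
    · rintro ⟨t, ht, h⟩
      refine ⟨t, ht, ?_⟩
      change rvPair t ω' = _ at h
      have h0 : x1 • t - l = 0 := by
        refine hωinj _ (fun i => hFFinf (F.sub_mem (F.mul_mem hx1F (hLamF t ht i)) (hl i))) ?_
        rw [rvPair_sub, rvPair_smul, h, mul_inv_cancel_left₀ hx1ne, sub_self]
      exact sub_eq_zero.1 h0
    · rintro ⟨t, ht, rfl⟩
      refine ⟨t, ht, ?_⟩
      simp only [rvPair_smul, inv_mul_cancel_left₀ hx1ne]
      rfl
  have hreps : ∀ S : Finset (Fin m → K),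
      IsTransv (LpSet (G : Set (K × (Fin m → K)))) (LamSet (G : Set (K × (Fin m → K))) v.1) x1 S →
      IsCosetReps M' N S (fun l => x1⁻¹ * rvPair l ω') := by
    rintro S ⟨hS, hS'⟩
    refine ⟨fun t ht => ⟨t, hS ht, (mul_inv_cancel_left₀ hx1ne _).symm⟩, ?_⟩
    rintro y ⟨l, hl, h⟩
    have hy : y = x1⁻¹ * rvPair l ω' := (eq_inv_mul_iff_mul_eq₀ hx1ne).2 h.symm
    have hiff : ∀ t, (t ∈ S ∧ y - x1⁻¹ * rvPair t ω' ∈ N) ↔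
        (t ∈ S ∧ l - t ∈ (fun t => x1 • t) '' LamSet (G : Set (K × (Fin m → K))) v.1) := fun t =>
      and_congr_right fun ht => by
        rw [hy, ← mul_sub, ← rvPair_sub]
        exact hmemN _ fun i => F.sub_mem (hLpF l hl i) (hLpF t (hS ht) i)
    simp only [hiff]
    exact hS' l hl
  have hident : ∀ S : Finset (Fin m → K),
      IsTransv (LpSet (G : Set (K × (Fin m → K)))) (LamSet (G : Set (K × (Fin m → K))) v.1) x1 S →
      lhsIdent (LpSet (G : Set (K × (Fin m → K)))) (LamSet (G : Set (K × (Fin m → K))) v.1)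
          x1 x' ω1 ω' S =
        rhsIdent (LamSet (G : Set (K × (Fin m → K))) v.1) x1 x' ω1 ω' S := by
    intro S hS
    have h := expF_mul_inv_pow_mul_prod_reps hM'disc hNdisc hNM' (hreps S hS) hexp
      (x1⁻¹ * rvPair x' ω')
    have hscale : expF (M : Set K) (x1 * ω1 + rvPair x' ω') =
        x1 * expF (M' : Set K) (ω1 + x1⁻¹ * rvPair x' ω') := by
      rw [show x1 * ω1 + rvPair x' ω' = x1 * (ω1 + x1⁻¹ * rvPair x' ω') by
        rw [mul_add, mul_inv_cancel_left₀ hx1ne], expF_mul_left _ hx1ne]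
      rfl
    rw [lhsIdent, rhsIdent, ← hM, ← hN, hscale, mul_assoc, mul_assoc, ← mul_assoc (expF _ _)]
    congr 1
    simp only [rvPair_smul, rvPair_sub, mul_sub]
    rw [← h]
    congr 1
    refine Finset.prod_congr rfl fun t ht => ?_
    simp only [hmemN t (hLpF t (hS.1 ht))]
  have hrhs : ∀ S : Finset (Fin m → K),
      IsTransv (LpSet (G : Set (K × (Fin m → K)))) (LamSet (G : Set (K × (Fin m → K))) v.1) x1 S →
      rhsIdent (LamSet (G : Set (K × (Fin m → K))) v.1) x1 x' ω1 ω' R =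
        rhsIdent (LamSet (G : Set (K × (Fin m → K))) v.1) x1 x' ω1 ω' S := by
    intro S hS
    rw [rhsIdent, rhsIdent, ← hN]
    simp only [rvPair_smul, rvPair_sub, mul_sub]
    congr 1
    refine (hreps R hR).prod_eq (hreps S hS) (f := fun z =>
      1 - expF (N : Set K) (z - x1⁻¹ * rvPair x' ω') * (expF (N : Set K) ω1)⁻¹) fun a b hab => ?_
    rw [expF_eq_of_sub_mem hNdisc (a := a - x1⁻¹ * rvPair x' ω') (b := b - x1⁻¹ * rvPair x' ω')]
    rwa [sub_sub_sub_cancel_right]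
  have hLpA : ∀ c ∈ Fq, ∀ l ∈ LpSet (G : Set (K × (Fin m → K))),
      c • l ∈ LpSet (G : Set (K × (Fin m → K))) := fun c hc l hl => by
    simpa [LpSet] using hLA c (hFqA hc) _ hl
  refine ⟨⟨N, hN⟩, ?_, hNdisc, ⟨M, hM⟩, ?_, hMdisc, hNdisc.multipliable ω1, hexp, hident R hR,
    fun S hS => ⟨?_, hrhs S hS⟩⟩
  · rintro c hc _ ⟨l, hl, rfl⟩
    refine ⟨c • l, fun x hx => ?_, rvPair_smul c l ω'⟩
    rw [smul_comm]
    exact hLpA c hc _ (hl x hx)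
  · rintro c hc _ ⟨l, hl, rfl⟩
    exact ⟨c • l, hLpA c hc l hl, rvPair_smul c l ω'⟩
  · rw [hident R hR, hident S hS, hrhs S hS]
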